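/- If a presence–absence matrix M : Fin m → Fin n → Bool contains no checkerboard unit (i.e., there is no pair of rows i ≠ j and pair of columns k ≠ l with M i k = true, M i l = false, M j k = false, M j l = true), then M is the unique presence–absence matrix with its row sums and column sums: any N : Fin m → Fin n → Bool with the same row sums and the same column sums equals M. -/

import Mathlib

/-- The row sum of row `i`: the number of columns `c` with `M i c = true`. -/
def rowSum {m n : ℕ} (M : Fin m → Fin n → Bool) (i : Fin m) : ℕ :=
  (Finset.univ.filter fun c => M i c = true).card

/-- The column sum of column `c`: the number of rows `i` with `M i c = true`. -/
def colSum {m n : ℕ} (M : Fin m → Fin n → Bool) (c : Fin n) : ℕ :=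
  (Finset.univ.filter fun i => M i c = true).card

theorem exists_swap_aux {n : ℕ} (f g : Fin n → Bool)
    (h : (Finset.univ.filter fun c => f c = true).card
      = (Finset.univ.filter fun c => g c = true).card)
    (a : Fin n) (hf : f a = true) (hg : g a = false) :
    ∃ b, f b = false ∧ g b = true := by
  by_contra hc
  push Not at hc
  have hs : (Finset.univ.filter fun c => g c = true)
      ⊆ (Finset.univ.filter fun c => f c = true) := by
    intro c hcg
    simp only [Finset.mem_filter, Finset.mem_univ, true_and] at hcg ⊢
    by_contra h1
    exact hc c (by simpa using h1) hcg
  have he := Finset.eq_of_subset_of_card_le hs h.le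
  have ha : a ∈ (Finset.univ.filter fun c => f c = true) := by simp [hf]
  rw [← he] at ha
  simp [hg] at ha

/-- If `M` contains no checkerboard unit, then `M` is the unique presence–absence
matrix with its row sums and column sums. -/
theorem no_checkerboard_unique_matrix {m n : ℕ} (M : Fin m → Fin n → Bool)
    (hM : ¬ ∃ (i j : Fin m) (k l : Fin n), i ≠ j ∧ k ≠ l ∧
        M i k = true ∧ M i l = false ∧ M j k = false ∧ M j l = true) :
    ∀ N : Fin m → Fin n → Bool,
      (∀ i, rowSum N i = rowSum M i) → (∀ c, colSum N c = colSum M c) → N = M := by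
  intro N hr hcol
  have key : ∀ (s : ℕ) (i : Fin m), rowSum M i = s → N i = M i := by
    intro s
    induction s using Nat.strong_induction_on with
    | _ s ih =>
      intro i hi
      by_contra hne
      have hk : ∃ k, M i k = true ∧ N i k = false := by
        obtain ⟨a, ha⟩ := Function.ne_iff.mp hne
        cases h1 : M i a with
        | true => exact ⟨a, h1, by simpa [h1] using ha⟩
        | false =>
          obtain ⟨b, hb1, hb2⟩ := exists_swap_aux (N i) (M i) (hr i) a
            (by simpa [h1] using ha) h1
          exact ⟨b, hb2, hb1⟩
      obtain ⟨k, hk1, hk2⟩ := hk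
      obtain ⟨j, hj1, hj2⟩ := exists_swap_aux (fun x => M x k) (fun x => N x k)
        (hcol k).symm i hk1 hk2
      have hlt : rowSum M j < rowSum M i := by
        apply Finset.card_lt_card
        rw [Finset.ssubset_iff_of_subset]
        · exact ⟨k, by simp [hk1], by simp [hj1]⟩
        · intro l hl
          simp only [Finset.mem_filter, Finset.mem_univ, true_and] at hl ⊢
          by_contra hil
          refine hM ⟨i, j, k, l, ?_, ?_, hk1, by simpa using hil, hj1, hl⟩
          · rintro rfl
            simp_all
          · rintro rfl
            simp_all
      have := ih _ (hi ▸ hlt) j rfl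
      rw [this, hj1] at hj2
      simp at hj2
  funext i
  exact key _ i rfl
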